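/- If a quadratic function f(x) = xᵀAx − 2bᵀx + c (A symmetric) is strictly positive on R^M, then there exists a constant d > 0 such that f(x) ≥ d for all x ∈ R^M. -/

import Mathlib

open Matrix

/-- A linear form vanishing on the kernel of a matrix `A` factors through `A`. -/
theorem exists_dotProduct_eq_dotProduct_mulVec {m n : Type*} [Fintype m] [DecidableEq m]
    [Fintype n] [DecidableEq n] {K : Type*} [Field K] (A : Matrix m n K) (b : n → K)
    (hb : ∀ v, A *ᵥ v = 0 → b ⬝ᵥ v = 0) :
    ∃ w : m → K, ∀ x, b ⬝ᵥ x = w ⬝ᵥ A *ᵥ x := by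
  have hmem : dotProductEquiv K n b ∈ A.mulVecLin.ker.dualAnnihilator := by
    rw [Submodule.mem_dualAnnihilator]
    exact hb
  rw [← LinearMap.range_dualMap_eq_dualAnnihilator_ker] at hmem
  obtain ⟨φ, hφ⟩ := hmem
  obtain ⟨w, rfl⟩ := (dotProductEquiv K m).surjective φ
  exact ⟨w, fun x => (LinearMap.congr_fun hφ x).symm⟩

/-- A real quadratic polynomial that is positive everywhere has nonnegative leading coefficient. -/
theorem leadingCoeff_nonneg_of_quadratic_pos {q β c : ℝ}
    (h : ∀ t : ℝ, 0 < t ^ 2 * q - 2 * (t * β) + c) : 0 ≤ q := by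
  by_contra! hq
  have hc : 0 < c := by simpa using h 0
  have hs : 0 < c / -q := div_pos hc (neg_pos.2 hq)
  have hsq : c / -q * q = -c := by
    rw [div_neg, neg_mul, div_mul_cancel₀ _ hq.ne]
  nlinarith [h (1 + c / -q), h (-(1 + c / -q)), mul_pos hs hs]

/-- A real affine function that is positive everywhere is constant. -/
theorem slope_eq_zero_of_affine_pos {β c : ℝ} (h : ∀ t : ℝ, 0 < c - 2 * (t * β)) : β = 0 := by
  by_contra hβ
  have h₀ := h 0
  have h₁ := h (c / β)
  rw [div_mul_cancel₀ _ hβ] at h₁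
  linarith

theorem positive_quadratic_bounded_below_by_positive_constant {M : ℕ}
    (A : Matrix (Fin M) (Fin M) ℝ) (hsymm : Aᵀ = A)
    (b : Fin M → ℝ) (c : ℝ)
    (hpos : ∀ x : Fin M → ℝ, 0 < x ⬝ᵥ A.mulVec x - 2 * (b ⬝ᵥ x) + c) :
    ∃ d : ℝ, 0 < d ∧ ∀ x : Fin M → ℝ,
      d ≤ x ⬝ᵥ A.mulVec x - 2 * (b ⬝ᵥ x) + c := by
  have hpsd (x : Fin M → ℝ) : 0 ≤ x ⬝ᵥ A *ᵥ x := by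
    refine leadingCoeff_nonneg_of_quadratic_pos (β := b ⬝ᵥ x) (c := c) fun t => ?_
    have h := hpos (t • x)
    simp only [mulVec_smul, dotProduct_smul, smul_dotProduct, smul_eq_mul] at h
    linarith
  have hker (v : Fin M → ℝ) (hv : A *ᵥ v = 0) : b ⬝ᵥ v = 0 := by
    refine slope_eq_zero_of_affine_pos (c := c) fun t => ?_
    have h := hpos (t • v)
    simp only [mulVec_smul, hv, dotProduct_smul, smul_eq_mul, dotProduct_zero, mul_zero] at h
    linarith
  obtain ⟨w, hw⟩ := exists_dotProduct_eq_dotProduct_mulVec A b hker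
  refine ⟨_, hpos w, fun x => ?_⟩
  have hcomm : x ⬝ᵥ A *ᵥ w = w ⬝ᵥ A *ᵥ x := by
    rw [dotProduct_mulVec, ← mulVec_transpose, hsymm, dotProduct_comm]
  have h := hpsd (x - w)
  simp only [mulVec_sub, dotProduct_sub, sub_dotProduct] at h
  rw [hw, hw]
  linarith
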